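/- Let (F, v) be a pre-2-henselian valued field, i.e., 1+m_v ⊆ R(F), with residue field k_v of characteristic ≠ 2. If R(F) ≠ F× and Γ_v ≠ 2Γ_v, then the Kaplansky radical is exactly R(F) = (1+m_v)·F×². -/

import Mathlib

/-- The Kaplansky radical `R(F)`. -/
def KRad (F : Type*) [Field F] : Set F :=
  {a : F | a ≠ 0 ∧ ∀ b : F, b ≠ 0 → ∃ u v : F, b = u ^ 2 - a * v ^ 2}

/-- `a` is represented by `⟨1, -b⟩` as soon as `b` is represented by `⟨1, -a⟩`. -/
theorem exists_eq_sq_sub_mul_sq_symm {F : Type*} [Field F] (h2 : (2 : F) ≠ 0) {a b : F}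
    (hb : b ≠ 0) (h : ∃ u w : F, b = u ^ 2 - a * w ^ 2) :
    ∃ u w : F, a = u ^ 2 - b * w ^ 2 := by
  obtain ⟨u, w, h⟩ := h
  by_cases hw : w = 0
  · have hu : u ≠ 0 := by
      rintro rfl
      exact hb (by rw [h, hw]; ring)
    refine ⟨(a + 1) / 2, (a - 1) / (2 * u), ?_⟩
    rw [h, hw]
    field_simp
    ring
  · refine ⟨u / w, 1 / w, ?_⟩
    rw [h]
    field_simp
    ring

/-- The Kaplansky radical is closed under multiplication. -/
theorem KRad.mul_mem {F : Type*} [Field F] (h2 : (2 : F) ≠ 0) {x y : F}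
    (hx : x ∈ KRad F) (hy : y ∈ KRad F) : x * y ∈ KRad F := by
  refine ⟨mul_ne_zero hx.1 hy.1, fun b hb => ?_⟩
  obtain ⟨u, w, h⟩ := exists_eq_sq_sub_mul_sq_symm h2 hb (hx.2 b hb)
  obtain ⟨u', w', h'⟩ := exists_eq_sq_sub_mul_sq_symm h2 hb (hy.2 b hb)
  refine exists_eq_sq_sub_mul_sq_symm h2 (mul_ne_zero hx.1 hy.1)
    ⟨u * u' + b * w * w', u * w' + w * u', ?_⟩
  rw [h, h']
  ring

/-- Nonzero squares lie in the Kaplansky radical. -/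
theorem KRad.sq_mem {F : Type*} [Field F] (h2 : (2 : F) ≠ 0) {c : F} (hc : c ≠ 0) :
    c ^ 2 ∈ KRad F :=
  ⟨pow_ne_zero 2 hc, fun _ _ =>
    exists_eq_sq_sub_mul_sq_symm h2 (pow_ne_zero 2 hc) ⟨c, 0, by ring⟩⟩

/-- A sum `x + y` with `y` of strictly smaller value than `x` is `x` times a `1`-unit. -/
theorem Valuation.exists_add_eq_one_add_mul {F Γ₀ : Type*} [Field F]
    [LinearOrderedCommGroupWithZero Γ₀] (v : Valuation F Γ₀) {x y : F} (h : v y < v x) :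
    ∃ t : F, v t < 1 ∧ x + y = (1 + t) * x := by
  have hvx : 0 < v x := zero_le.trans_lt h
  have hx : x ≠ 0 := v.pos_iff.1 hvx
  refine ⟨y / x, ?_, by field_simp⟩
  rw [map_div₀]
  exact (div_lt_one₀ hvx).2 h

/-- If the value of `a` is not a square, every nonzero `u ^ 2 - a * w ^ 2` is a `1`-unit times
`c ^ 2` or `-a * c ^ 2`. -/
theorem Valuation.sq_sub_mul_sq_cases {F Γ₀ : Type*} [Field F]
    [LinearOrderedCommGroupWithZero Γ₀] (v : Valuation F Γ₀) {a u w : F}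
    (ha : ∀ c : F, v a ≠ v c ^ 2) (h0 : u ^ 2 - a * w ^ 2 ≠ 0) :
    ∃ t c : F, v t < 1 ∧ c ≠ 0 ∧
      (u ^ 2 - a * w ^ 2 = (1 + t) * c ^ 2 ∨ u ^ 2 - a * w ^ 2 = (1 + t) * (-a * c ^ 2)) := by
  rcases lt_trichotomy (v (-a * w ^ 2)) (v (u ^ 2)) with h | h | h
  · obtain ⟨t, ht, e⟩ := v.exists_add_eq_one_add_mul h
    refine ⟨t, u, ht, ?_, Or.inl (by rw [← e]; ring)⟩
    rintro rfl
    simp at h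
  · exfalso
    by_cases hw : w = 0
    · apply h0
      have hu : v (u ^ 2) = 0 := by rw [← h, hw]; simp
      rw [v.zero_iff.1 hu, hw]
      ring
    · apply ha (u / w)
      have hvw : v w ≠ 0 := v.ne_zero_iff.2 hw
      rw [map_div₀, div_pow, eq_div_iff (pow_ne_zero 2 hvw)]
      simpa [v.map_neg] using h
  · obtain ⟨t, ht, e⟩ := v.exists_add_eq_one_add_mul h
    refine ⟨t, w, ht, ?_, Or.inr (by rw [← e]; ring)⟩
    rintro rfl
    simp at h

/-- Let `(F, v)` be a pre-`2`-henselian valued field, i.e.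
`1 + m_v ⊆ R(F)` (where `m_v = {t | v t < 1}` is the maximal ideal of the valuation
ring of the surjective valuation `v : F → Γ₀`), with residue characteristic `≠ 2`
(`v 2 = 1`).  If `R(F) ≠ F×` and `Γ_v ≠ 2Γ_v` (there is a nonzero non-square value),
then the Kaplansky radical is exactly `R(F) = (1 + m_v)·F×²`. -/
theorem radical_of_pre_two_henselian
    {F Γ₀ : Type*} [Field F] [LinearOrderedCommGroupWithZero Γ₀]
    (v : Valuation F Γ₀) (hvsurj : Function.Surjective v)
    (hchar : ringChar F ≠ 2) (hres2 : v 2 = 1)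
    (hpre : ∀ t : F, v t < 1 → (1 + t) ∈ KRad F)
    (hRne : KRad F ≠ {b : F | b ≠ 0})
    (hΓ : ∃ γ : Γ₀, γ ≠ 0 ∧ ¬∃ ρ : Γ₀, γ = ρ ^ 2) :
    KRad F = {z : F | ∃ t c : F, v t < 1 ∧ c ≠ 0 ∧ z = (1 + t) * c ^ 2} := by
  have h2 : (2 : F) ≠ 0 := v.ne_zero_iff.1 (by rw [hres2]; exact one_ne_zero)
  have hS : ∀ t c : F, v t < 1 → c ≠ 0 → (1 + t) * c ^ 2 ∈ KRad F := fun t c ht hc =>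
    KRad.mul_mem h2 (hpre t ht) (KRad.sq_mem h2 hc)
  have heven : ∀ a ∈ KRad F, ∃ c : F, v a = v c ^ 2 := by
    intro a haR
    by_contra! ha
    have hneg : (-1 : F) ∈ KRad F := by
      obtain ⟨u, w, h⟩ := haR.2 (-1) (by simp)
      obtain ⟨t, c, ht, hc, e | e⟩ :=
        v.sq_sub_mul_sq_cases ha (u := u) (w := w) (by rw [← h]; simp)
      · rw [h, e]
        exact hS t c ht hc
      · exfalso
        have hv := congrArg v (h.trans e)
        rw [map_mul, v.map_one_add_of_lt ht] at hv
        simp only [map_mul, Valuation.map_neg, map_one, map_pow, one_mul] at hv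
        apply ha c⁻¹
        rw [map_inv₀, inv_pow]
        exact eq_inv_of_mul_eq_one_left hv.symm
    refine hRne (Set.Subset.antisymm (fun x hx => hx.1) fun b hb => ?_)
    obtain ⟨u, w, h⟩ := haR.2 b hb
    obtain ⟨t, c, ht, hc, e | e⟩ := v.sq_sub_mul_sq_cases ha (u := u) (w := w) (h ▸ hb)
    · rw [h, e]
      exact hS t c ht hc
    · have hb' : b = (-1) * a * ((1 + t) * c ^ 2) := by rw [h, e]; ring
      rw [hb']
      exact KRad.mul_mem h2 (KRad.mul_mem h2 hneg haR) (hS t c ht hc)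
  ext a
  constructor
  · intro haR
    obtain ⟨γ, hγ, hodd⟩ := hΓ
    obtain ⟨p, rfl⟩ := hvsurj γ
    obtain ⟨d, hd⟩ := heven a haR
    obtain ⟨u, w, h⟩ := haR.2 p (v.ne_zero_iff.1 hγ)
    have hw : w ≠ 0 := by
      rintro rfl
      exact hodd ⟨v u, by rw [h]; simp⟩
    have hlt : v (-p) < v (u ^ 2) := by
      rw [v.map_neg]
      by_contra! hle
      rcases hle.eq_or_lt with he | hl
      · exact hodd ⟨v u, by rw [← he, map_pow]⟩
      · refine hodd ⟨v d * v w, ?_⟩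
        have e : a * w ^ 2 = u ^ 2 - p := by rw [h]; ring
        rw [mul_pow, ← hd, ← map_pow, ← map_mul, e, v.map_sub_swap,
          v.map_sub_eq_of_lt_left hl]
    obtain ⟨t, ht, e⟩ := v.exists_add_eq_one_add_mul hlt
    have hu : u ≠ 0 := by
      rintro rfl
      simp at hlt
    refine ⟨t, u / w, ht, div_ne_zero hu hw, ?_⟩
    rw [div_pow, ← mul_div_assoc, ← e, h]
    field_simp
    ring
  · rintro ⟨t, c, ht, hc, rfl⟩
    exact hS t c ht hc
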